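/- arXiv:1611.03339 — 6 statements merged into one kernel-verified Lean document; each statement's English description precedes it below -/
import Mathlib

section
/- Let p > 0, let b : ℕ → ℂ be a p-mean convergent sequence with limit β (i.e. n^{-p} Σ_{k=1}^n b_k → β), and let f : (0,1] → ℝ be a monotone function such that x ↦ x^{p-1} f(x) is Lebesgue integrable on (0,1] and x ↦ x^p is integrable on (0,1] with respect to the Stieltjes measure |df| associated to f. Then lim_{n→∞} n^{-p} Σ_{k=1}^n b_k f(k/n) = β · p · ∫_0^1 x^{p-1} f(x) dx. -/
open Filter Finset Topology MeasureTheory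

/-- Abel summation over `{1, …, n}`. -/
lemma sum_Icc_mul_eq_sum_partialSum_mul_sub {R : Type*} [CommRing R] (b u : ℕ → R) (n : ℕ) :
    ∑ k ∈ Finset.Icc 1 n, b k * u k =
      ∑ k ∈ Finset.Icc 1 n, (∑ j ∈ Finset.Icc 1 k, b j) * (u k - u (k + 1)) +
        (∑ j ∈ Finset.Icc 1 n, b j) * u (n + 1) := by
  induction n with
  | zero => simp
  | succ n ih =>
    simp only [Finset.sum_Icc_succ_top (Nat.le_add_left 1 n)] at ih ⊢
    rw [ih]
    ring

/-- Toeplitz's lemma for nonnegative triangular weights. -/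
lemma tendsto_sum_mul_of_tendsto_of_weights (w : ℕ → ℕ → ℝ) (m : ℕ → ℂ) (β : ℂ) (L : ℝ)
    (hw : ∀ n, ∀ k ∈ Finset.Icc 1 n, 0 ≤ w n k)
    (hw_zero : ∀ k, 1 ≤ k → Tendsto (fun n => w n k) atTop (𝓝 0))
    (hw_sum : Tendsto (fun n => ∑ k ∈ Finset.Icc 1 n, w n k) atTop (𝓝 L))
    (hm : Tendsto m atTop (𝓝 β)) :
    Tendsto (fun n => ∑ k ∈ Finset.Icc 1 n, (w n k : ℂ) * m k) atTop (𝓝 (β * L)) := by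
  have herr : Tendsto (fun n => ∑ k ∈ Finset.Icc 1 n, (w n k : ℂ) * (m k - β)) atTop (𝓝 0) := by
    rw [Metric.tendsto_atTop']
    intro ε hε
    have hC : 0 < |L| + 1 := by positivity
    have hδ : 0 < ε / (2 * (|L| + 1)) := by positivity
    obtain ⟨K, hK⟩ := Metric.tendsto_atTop.1 hm _ hδ
    have hhead : Tendsto (fun n => ∑ k ∈ Finset.Icc 1 K, w n k * ‖m k - β‖) atTop (𝓝 0) := by
      have := tendsto_finsetSum (Finset.Icc 1 K) fun k hk =>
        (hw_zero k (Finset.mem_Icc.1 hk).1).mul_const ‖m k - β‖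
      simpa using this
    have hev := (hhead.eventually_lt_const (half_pos hε)).and
      ((hw_sum.eventually_lt_const (lt_of_le_of_lt (le_abs_self L) (lt_add_one _))).and
        (eventually_ge_atTop K))
    obtain ⟨N, hN⟩ := eventually_atTop.1 hev
    refine ⟨N, fun n hn => ?_⟩
    obtain ⟨h1, h2, h3⟩ := hN n hn.le
    rw [dist_zero_right]
    have hnn : ∀ k ∈ Finset.Icc 1 n, 0 ≤ w n k * (ε / (2 * (|L| + 1))) := fun k hk =>
      mul_nonneg (hw n k hk) hδ.le
    calc ‖∑ k ∈ Finset.Icc 1 n, (w n k : ℂ) * (m k - β)‖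
        ≤ ∑ k ∈ Finset.Icc 1 n, w n k * ‖m k - β‖ := by
          refine (norm_sum_le _ _).trans (Finset.sum_le_sum fun k hk => ?_)
          rw [norm_mul, Complex.norm_real, Real.norm_of_nonneg (hw n k hk)]
      _ ≤ ∑ k ∈ Finset.Icc 1 n, ((if k ≤ K then w n k * ‖m k - β‖ else 0) +
            w n k * (ε / (2 * (|L| + 1)))) := by
          refine Finset.sum_le_sum fun k hk => ?_
          split_ifs with hkK
          · linarith [hnn k hk]
          · have := hK k (by omega)
            rw [dist_eq_norm] at this
            rw [zero_add]
            exact mul_le_mul_of_nonneg_left this.le (hw n k hk)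
      _ = ∑ k ∈ Finset.Icc 1 K, w n k * ‖m k - β‖ +
            (∑ k ∈ Finset.Icc 1 n, w n k) * (ε / (2 * (|L| + 1))) := by
          rw [Finset.sum_add_distrib, ← Finset.sum_filter, ← Finset.sum_mul]
          congr 2
          ext k
          simp only [Finset.mem_filter, Finset.mem_Icc]
          omega
      _ < ε / 2 + (|L| + 1) * (ε / (2 * (|L| + 1))) :=
          add_lt_add h1 (mul_lt_mul_of_pos_right h2 hδ)
      _ = ε := by field_simp; norm_num
  have hmain : Tendsto (fun n => β * ((∑ k ∈ Finset.Icc 1 n, w n k : ℝ) : ℂ)) atTop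
      (𝓝 (β * L)) :=
    ((Complex.continuous_ofReal.tendsto L).comp hw_sum).const_mul β
  have := herr.add hmain
  rw [zero_add] at this
  refine this.congr fun n => ?_
  push_cast
  rw [Finset.mul_sum, ← Finset.sum_add_distrib]
  exact Finset.sum_congr rfl fun k _ => by ring

section AntitoneWeight

variable {p : ℝ} {g : ℝ → ℝ}

lemma integral_Ioc_mul_rpow_sub_one (hp : 0 < p) {a c : ℝ} (hac : a ≤ c) :
    ∫ x in Set.Ioc a c, p * x ^ (p - 1) = c ^ p - a ^ p := by
  rw [← intervalIntegral.integral_of_le hac, intervalIntegral.integral_const_mul,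
    integral_rpow (Or.inl (by linarith)), sub_add_cancel]
  field_simp

/-- The `p`-weighted Riemann sum as the integral of a step function. -/
lemma integral_rpow_mul_comp_ceil (hp : 0 < p) (g : ℝ → ℝ) {n : ℕ} (hn : 0 < n) :
    ∫ x in Set.Ioc (0 : ℝ) 1, p * x ^ (p - 1) * g (⌈x * n⌉₊ / n) =
      ((n : ℝ) ^ p)⁻¹ * ∑ k ∈ Finset.Icc 1 n, ((k : ℝ) ^ p - ((k - 1 : ℕ) : ℝ) ^ p) * g (k / n) := by
  have hn' : (0 : ℝ) < n := by exact_mod_cast hn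
  have hle : ∀ k : ℕ, (k : ℝ) / n ≤ ((k + 1 : ℕ) : ℝ) / n := fun k => by
    push_cast
    gcongr
    linarith
  have heq : ∀ k : ℕ, Set.EqOn (fun x : ℝ => p * x ^ (p - 1) * g (⌈x * n⌉₊ / n))
      (fun x => p * x ^ (p - 1) * g ((k + 1 : ℕ) / n))
      (Set.Ioc ((k : ℝ) / n) ((k + 1 : ℕ) / n)) := by
    intro k x hx
    have hceil : ⌈x * n⌉₊ = k + 1 := by
      rw [Nat.ceil_eq_iff (Nat.succ_ne_zero k)]
      exact ⟨by simpa using (div_lt_iff₀ hn').1 hx.1, (le_div_iff₀ hn').1 hx.2⟩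
    simp only [hceil]
  have hint : ∀ k < n, IntervalIntegrable (fun x : ℝ => p * x ^ (p - 1) * g (⌈x * n⌉₊ / n))
      volume ((k : ℝ) / n) ((k + 1 : ℕ) / n) := by
    intro k _
    have h := ((intervalIntegral.intervalIntegrable_rpow' (r := p - 1) (a := (k : ℝ) / n)
      (b := ((k + 1 : ℕ) : ℝ) / n) (by linarith)).const_mul p).mul_const (g ((k + 1 : ℕ) / n))
    rw [intervalIntegrable_iff_integrableOn_Ioc_of_le (hle k)] at h ⊢
    exact h.congr_fun (heq k).symm measurableSet_Ioc
  have hsum := intervalIntegral.sum_integral_adjacent_intervals (a := fun k : ℕ => (k : ℝ) / n) hint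
  simp only [Nat.cast_zero, zero_div, div_self hn'.ne'] at hsum
  rw [← intervalIntegral.integral_of_le zero_le_one, ← hsum, Finset.mul_sum,
    ← Finset.Ico_succ_right_eq_Icc, Finset.sum_Ico_eq_sum_range]
  refine Finset.sum_congr (by simp) fun k _ => ?_
  rw [intervalIntegral.integral_of_le (hle k), setIntegral_congr_fun measurableSet_Ioc (heq k),
    integral_mul_const, integral_Ioc_mul_rpow_sub_one hp (hle k), add_comm 1 k,
    Nat.add_sub_cancel, Real.div_rpow (by positivity) hn'.le, Real.div_rpow (by positivity) hn'.le]
  ring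

lemma tendsto_integral_rpow_mul_comp_ceil (hp : 0 < p) (hg : AntitoneOn g (Set.Ioi 0))
    (hg1 : ∀ x, 1 ≤ x → g x = 0)
    (hgint : IntegrableOn (fun x : ℝ => x ^ (p - 1) * g x) (Set.Ioc 0 1) volume) :
    Tendsto (fun n : ℕ => ∫ x in Set.Ioc (0 : ℝ) 1, p * x ^ (p - 1) * g (⌈x * n⌉₊ / n)) atTop
      (𝓝 (p * ∫ x in Set.Ioc (0 : ℝ) 1, x ^ (p - 1) * g x)) := by
  have hg0 : ∀ x, 0 < x → 0 ≤ g x := fun x hx => by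
    rw [← hg1 (max x 1) (le_max_right _ _)]
    exact hg hx (hx.trans_le (le_max_left _ _)) (le_max_left _ _)
  rw [← integral_const_mul, ← tendsto_add_atTop_iff_nat 1]
  refine tendsto_integral_of_dominated_convergence (fun x => p * (x ^ (p - 1) * g x))
    (fun n => ?_) (hgint.const_mul p) (fun n => ?_) ?_
  · have h1 : Measurable fun x : ℝ => g (⌈x * (n + 1 : ℕ)⌉₊ / (n + 1 : ℕ)) :=
      (measurable_from_nat (f := fun k : ℕ => g (k / (n + 1 : ℕ)))).comp
        (Nat.measurable_ceil.comp (measurable_id.mul_const _))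
    exact (((measurable_id.pow_const _).const_mul p).mul h1).aestronglyMeasurable
  · filter_upwards [ae_restrict_mem measurableSet_Ioc] with x hx
    have hn : (0 : ℝ) < (n + 1 : ℕ) := by positivity
    have hxc : x ≤ (⌈x * (n + 1 : ℕ)⌉₊ : ℝ) / (n + 1 : ℕ) :=
      (le_div_iff₀ hn).2 (Nat.le_ceil _)
    have hx0 : 0 < x := hx.1
    have hc0 := hx0.trans_le hxc
    have := hg0 _ hc0
    rw [Real.norm_of_nonneg (by positivity), mul_assoc]
    gcongr
    exact hg hx0 hc0 hxc
  · have hcount := hg.countable_not_continuousWithinAt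
    filter_upwards [ae_restrict_mem measurableSet_Ioc,
      ae_restrict_of_ae (hcount.ae_notMem volume)] with x hx hxc
    have hx0 : x ∈ Set.Ioi (0 : ℝ) := hx.1
    have hcont : ContinuousAt g x := by
      have : ContinuousWithinAt g (Set.Ioi 0) x := by
        by_contra h
        exact hxc ⟨hx0, h⟩
      exact this.continuousAt (Ioi_mem_nhds hx0)
    have hceil : Tendsto (fun n : ℕ => (⌈x * (n + 1 : ℕ)⌉₊ : ℝ) / (n + 1 : ℕ)) atTop (𝓝 x) :=
      (tendsto_nat_ceil_mul_div_atTop hx.1.le).comp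
        (tendsto_natCast_atTop_atTop.comp (tendsto_add_atTop_nat 1))
    rw [← mul_assoc]
    exact (hcont.tendsto.comp hceil).const_mul _

lemma tendsto_inv_rpow_mul_apply_inv (hp : 0 < p) (hg : AntitoneOn g (Set.Ioi 0))
    (hg0 : ∀ x, 0 < x → 0 ≤ g x)
    (hgint : IntegrableOn (fun x : ℝ => x ^ (p - 1) * g x) (Set.Ioc 0 1) volume) :
    Tendsto (fun n : ℕ => ((n : ℝ) ^ p)⁻¹ * g (1 / n)) atTop (𝓝 0) := by
  rw [← tendsto_add_atTop_iff_nat 1]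
  have hanti : Antitone fun n : ℕ => Set.Ioc (0 : ℝ) (1 / ((n + 1 : ℕ) : ℝ)) := fun m n hmn =>
    Set.Ioc_subset_Ioc_right (by gcongr)
  have hinter : ⋂ n : ℕ, Set.Ioc (0 : ℝ) (1 / ((n + 1 : ℕ) : ℝ)) = ∅ := by
    refine Set.eq_empty_of_forall_notMem fun x hx => ?_
    have hx' := Set.mem_iInter.1 hx
    obtain ⟨n, hn⟩ := exists_nat_one_div_lt (hx' 0).1
    have := (hx' n).2
    push_cast at this
    linarith
  have hpgint : IntegrableOn (fun x : ℝ => p * (x ^ (p - 1) * g x)) (Set.Ioc 0 1) volume :=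
    hgint.const_mul p
  have hlim := tendsto_setIntegral_of_antitone (μ := volume)
    (f := fun x : ℝ => p * (x ^ (p - 1) * g x)) (fun _ => measurableSet_Ioc) hanti
    ⟨0, by simpa using hpgint⟩
  rw [hinter, setIntegral_empty] at hlim
  refine squeeze_zero (fun n => ?_) (fun n => ?_) hlim
  · have := hg0 (1 / ((n + 1 : ℕ) : ℝ)) (by positivity)
    positivity
  · have hn : (0 : ℝ) < 1 / ((n + 1 : ℕ) : ℝ) := by positivity
    have hn1 : 1 / ((n + 1 : ℕ) : ℝ) ≤ 1 := by
      simpa using hanti (Nat.zero_le n) (Set.right_mem_Ioc.2 hn) |>.2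
    have hval : (((n + 1 : ℕ) : ℝ) ^ p)⁻¹ = ∫ x in Set.Ioc 0 (1 / ((n + 1 : ℕ) : ℝ)),
        p * x ^ (p - 1) := by
      rw [integral_Ioc_mul_rpow_sub_one hp hn.le, Real.zero_rpow hp.ne', sub_zero, one_div,
        Real.inv_rpow (by positivity)]
    have hrpow : IntegrableOn (fun x : ℝ => x ^ (p - 1)) (Set.Ioc 0 (1 / ((n + 1 : ℕ) : ℝ))) :=
      (intervalIntegrable_iff_integrableOn_Ioc_of_le hn.le).1
        (intervalIntegral.intervalIntegrable_rpow' (by linarith))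
    rw [hval, ← integral_mul_const]
    refine setIntegral_mono_on ((hrpow.const_mul p).mul_const _)
      (hpgint.mono_set (Set.Ioc_subset_Ioc_right hn1)) measurableSet_Ioc
      fun x hx => ?_
    have hx0 : 0 < x := hx.1
    rw [mul_assoc]
    gcongr
    exact hg hx0 hn hx.2

lemma tendsto_weighted_mean_of_antitoneOn_Ioi (hp : 0 < p) {b : ℕ → ℂ} {β : ℂ}
    (hb : Tendsto (fun n : ℕ => ((((n : ℝ) ^ p : ℝ)) : ℂ)⁻¹ * ∑ k ∈ Finset.Icc 1 n, b k)
      atTop (𝓝 β))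
    (hg : AntitoneOn g (Set.Ioi 0)) (hg1 : ∀ x, 1 ≤ x → g x = 0)
    (hgint : IntegrableOn (fun x : ℝ => x ^ (p - 1) * g x) (Set.Ioc 0 1) volume) :
    Tendsto
      (fun n : ℕ => ((((n : ℝ) ^ p : ℝ)) : ℂ)⁻¹ *
        ∑ k ∈ Finset.Icc 1 n, b k * (g ((k : ℝ) / (n : ℝ)) : ℂ))
      atTop
      (𝓝 (β * (p : ℂ) * ((∫ x in Set.Ioc (0 : ℝ) 1, x ^ (p - 1) * g x) : ℝ))) := by
  have hg0 : ∀ x, 0 < x → 0 ≤ g x := fun x hx => by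
    rw [← hg1 (max x 1) (le_max_right _ _)]
    exact hg hx (hx.trans_le (le_max_left _ _)) (le_max_left _ _)
  have hend : ∀ n : ℕ, 0 < n → g (((n + 1 : ℕ) : ℝ) / n) = 0 := fun n hn => by
    have hn' : (0 : ℝ) < n := by exact_mod_cast hn
    refine hg1 _ ((one_le_div hn').2 ?_)
    push_cast
    linarith
  have hdiff : ∀ n k : ℕ, 0 < n → 1 ≤ k →
      0 ≤ g ((k : ℝ) / n) - g (((k + 1 : ℕ) : ℝ) / n) := fun n k hn hk => by
    have hn' : (0 : ℝ) < n := by exact_mod_cast hn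
    have hk' : (0 : ℝ) < k := by exact_mod_cast hk
    refine sub_nonneg.2 (hg (Set.mem_Ioi.2 (by positivity)) (Set.mem_Ioi.2 (by positivity)) ?_)
    push_cast
    gcongr
    linarith
  set w : ℕ → ℕ → ℝ := fun n k =>
    ((n : ℝ) ^ p)⁻¹ * ((k : ℝ) ^ p * (g ((k : ℝ) / n) - g (((k + 1 : ℕ) : ℝ) / n))) with hw
  have hw_nonneg : ∀ n k, 0 < n → 1 ≤ k → 0 ≤ w n k := fun n k hn hk => by
    have := hdiff n k hn hk
    simp only [hw]
    positivity
  have hw_zero : ∀ k, 1 ≤ k → Tendsto (fun n => w n k) atTop (𝓝 0) := by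
    intro k hk
    have hlim := (tendsto_inv_rpow_mul_apply_inv hp hg hg0 hgint).const_mul ((k : ℝ) ^ p)
    rw [mul_zero] at hlim
    refine squeeze_zero' ?_ ?_ hlim
    · filter_upwards [eventually_gt_atTop 0] with n hn using hw_nonneg n k hn hk
    · filter_upwards [eventually_gt_atTop 0] with n hn
      have hn' : (0 : ℝ) < n := by exact_mod_cast hn
      have hk' : (1 : ℝ) ≤ k := by exact_mod_cast hk
      have h1 : g ((k : ℝ) / n) ≤ g (1 / n) :=
        hg (Set.mem_Ioi.2 (by positivity)) (Set.mem_Ioi.2 (by positivity)) (by gcongr)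
      have h2 := hg0 (((k + 1 : ℕ) : ℝ) / n) (by positivity)
      simp only [hw]
      rw [mul_left_comm]
      gcongr
      linarith
  have hw_sum : Tendsto (fun n => ∑ k ∈ Finset.Icc 1 n, w n k) atTop
      (𝓝 (p * ∫ x in Set.Ioc (0 : ℝ) 1, x ^ (p - 1) * g x)) := by
    refine (tendsto_integral_rpow_mul_comp_ceil hp hg hg1 hgint).congr' ?_
    filter_upwards [eventually_gt_atTop 0] with n hn
    have htel : ∀ k : ℕ,
        ∑ j ∈ Finset.Icc 1 k, ((j : ℝ) ^ p - ((j - 1 : ℕ) : ℝ) ^ p) = (k : ℝ) ^ p := by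
      intro k
      induction k with
      | zero => simp [Real.zero_rpow hp.ne']
      | succ k ih =>
        rw [Finset.sum_Icc_succ_top (Nat.le_add_left 1 k), ih, Nat.add_sub_cancel]
        ring
    rw [integral_rpow_mul_comp_ceil hp g hn,
      sum_Icc_mul_eq_sum_partialSum_mul_sub _ (fun k : ℕ => g ((k : ℝ) / n)), hend n hn]
    simp only [htel, mul_zero, add_zero, Finset.mul_sum, hw]
  have hlim := tendsto_sum_mul_of_tendsto_of_weights w _ β _
    (fun n k hk => hw_nonneg n k
      (lt_of_lt_of_le (Finset.mem_Icc.1 hk).1 (Finset.mem_Icc.1 hk).2) (Finset.mem_Icc.1 hk).1)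
    hw_zero hw_sum hb
  rw [mul_assoc, ← Complex.ofReal_mul]
  refine hlim.congr' ?_
  filter_upwards [eventually_gt_atTop 0] with n hn
  rw [sum_Icc_mul_eq_sum_partialSum_mul_sub b (fun k : ℕ => (g ((k : ℝ) / n) : ℂ)), hend n hn,
    Complex.ofReal_zero, mul_zero, add_zero, Finset.mul_sum]
  refine Finset.sum_congr rfl fun k hk => ?_
  have hk0 : (((k : ℝ) ^ p : ℝ) : ℂ) ≠ 0 := by
    have : (0 : ℝ) < k := by exact_mod_cast (Finset.mem_Icc.1 hk).1
    exact_mod_cast (Real.rpow_pos_of_pos this p).ne'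
  simp only [hw, Complex.ofReal_mul, Complex.ofReal_inv, Complex.ofReal_sub]
  field_simp

end AntitoneWeight

lemma tendsto_weighted_mean_of_antitoneOn {p : ℝ} (hp : 0 < p) {b : ℕ → ℂ} {β : ℂ} {f : ℝ → ℝ}
    (hb : Tendsto (fun n : ℕ => ((((n : ℝ) ^ p : ℝ)) : ℂ)⁻¹ * ∑ k ∈ Finset.Icc 1 n, b k)
      atTop (𝓝 β))
    (hf : AntitoneOn f (Set.Ioc 0 1))
    (hfint : IntegrableOn (fun x : ℝ => x ^ (p - 1) * f x) (Set.Ioc 0 1) volume) :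
    Tendsto
      (fun n : ℕ => ((((n : ℝ) ^ p : ℝ)) : ℂ)⁻¹ *
        ∑ k ∈ Finset.Icc 1 n, b k * (f ((k : ℝ) / (n : ℝ)) : ℂ))
      atTop
      (𝓝 (β * (p : ℂ) * ((∫ x in Set.Ioc (0 : ℝ) 1, x ^ (p - 1) * f x) : ℝ))) := by
  set g : ℝ → ℝ := fun x => f (min x 1) - f 1 with hgdef
  have hmem : ∀ x : ℝ, 0 < x → min x 1 ∈ Set.Ioc (0 : ℝ) 1 := fun x hx =>
    ⟨lt_min hx one_pos, min_le_right _ _⟩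
  have hg : AntitoneOn g (Set.Ioi 0) := fun x hx y hy hxy =>
    sub_le_sub_right (hf (hmem x hx) (hmem y hy) (min_le_min_right 1 hxy)) _
  have hg1 : ∀ x, 1 ≤ x → g x = 0 := fun x hx => by simp [hgdef, min_eq_right hx]
  have hfg : ∀ x, x ≤ 1 → f x = g x + f 1 := fun x hx => by simp [hgdef, min_eq_left hx]
  have hrpow : IntegrableOn (fun x : ℝ => x ^ (p - 1)) (Set.Ioc 0 1) :=
    (intervalIntegrable_iff_integrableOn_Ioc_of_le zero_le_one).1
      (intervalIntegral.intervalIntegrable_rpow' (by linarith))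
  have hgint : IntegrableOn (fun x : ℝ => x ^ (p - 1) * g x) (Set.Ioc 0 1) volume := by
    refine (hfint.sub (hrpow.mul_const (f 1))).congr_fun (fun x hx => ?_) measurableSet_Ioc
    simp only [Pi.sub_apply, hfg x hx.2]
    ring
  have hone : p * ∫ x in Set.Ioc (0 : ℝ) 1, x ^ (p - 1) = 1 := by
    rw [← integral_const_mul, integral_Ioc_mul_rpow_sub_one hp zero_le_one, Real.one_rpow,
      Real.zero_rpow hp.ne', sub_zero]
  have hintegral : p * ∫ x in Set.Ioc (0 : ℝ) 1, x ^ (p - 1) * f x =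
      p * (∫ x in Set.Ioc (0 : ℝ) 1, x ^ (p - 1) * g x) + f 1 := by
    rw [setIntegral_congr_fun (g := fun x => x ^ (p - 1) * g x + x ^ (p - 1) * f 1)
      measurableSet_Ioc fun x hx => by simp only [hfg x hx.2, mul_add],
      integral_add hgint (hrpow.mul_const _), integral_mul_const, mul_add, ← mul_assoc p, hone,
      one_mul]
  have hlim := (tendsto_weighted_mean_of_antitoneOn_Ioi hp hb hg hg1 hgint).add
    (hb.mul_const (f 1 : ℂ))
  rw [mul_assoc, ← Complex.ofReal_mul, ← mul_add, ← Complex.ofReal_add, ← hintegral,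
    Complex.ofReal_mul, ← mul_assoc] at hlim
  refine hlim.congr fun n => ?_
  rw [mul_assoc _ _ (f 1 : ℂ), ← mul_add, Finset.sum_mul, ← Finset.sum_add_distrib]
  congr 1
  refine Finset.sum_congr rfl fun k hk => ?_
  rw [hfg ((k : ℝ) / n) (div_le_one_of_le₀ (by exact_mod_cast (Finset.mem_Icc.1 hk).2)
    (Nat.cast_nonneg n)), Complex.ofReal_add, mul_add]

/-- **Main theorem on high order weighted Cesàro means.**
Let `p > 0`, let `b` be a `p`-mean convergent sequence with limit `β`
(sequences indexed by `ℕ = {1, 2, …}`), and let `f` be monotone on `(0, 1]` with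
`x ↦ x^(p-1) f x` Lebesgue integrable on `(0, 1]`.  Let `μ` be the Borel measure `|df|`
on `(0, 1]` induced by the Stieltjes integral with respect to `f` (described via right
limits of `f`, which is the Stieltjes assignment of mass `|f(c⁺) - f(a⁺)|` to `(a, c]`),
and assume `x ↦ x^p` is `μ`-integrable on `(0, 1]`.  Then
`n⁻ᵖ ∑_{k=1}^n b_k f(k/n) → β p ∫_0^1 x^(p-1) f x dx`. -/
theorem weighted_cesaro_mean_tendsto
    (p : ℝ) (hp : 0 < p) (b : ℕ → ℂ) (β : ℂ) (f : ℝ → ℝ)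
    (hb : Tendsto (fun n : ℕ => ((((n : ℝ) ^ p : ℝ)) : ℂ)⁻¹ * ∑ k ∈ Finset.Icc 1 n, b k)
      atTop (𝓝 β))
    (hmono : MonotoneOn f (Set.Ioc 0 1) ∨ AntitoneOn f (Set.Ioc 0 1))
    (hfint : IntegrableOn (fun x : ℝ => x ^ (p - 1) * f x) (Set.Ioc 0 1) volume)
    (μ : Measure ℝ)
    (hμ : ∀ a c : ℝ, 0 < a → a ≤ c → c < 1 →
      μ (Set.Ioc a c) = ENNReal.ofReal |Function.rightLim f c - Function.rightLim f a|)
    (hμ₁ : ∀ a : ℝ, 0 < a → a < 1 →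
      μ (Set.Ioc a 1) = ENNReal.ofReal |f 1 - Function.rightLim f a|)
    (hxp : IntegrableOn (fun x : ℝ => x ^ p) (Set.Ioc 0 1) μ) :
    Tendsto
      (fun n : ℕ => ((((n : ℝ) ^ p : ℝ)) : ℂ)⁻¹ *
        ∑ k ∈ Finset.Icc 1 n, b k * (f ((k : ℝ) / (n : ℝ)) : ℂ))
      atTop
      (𝓝 (β * (p : ℂ) * ((∫ x in Set.Ioc (0 : ℝ) 1, x ^ (p - 1) * f x) : ℝ))) := by
  rcases hmono with hf | hf
  · have hlim := (tendsto_weighted_mean_of_antitoneOn hp hb hf.neg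
      (hfint.neg.congr_fun (fun x _ => by simp) measurableSet_Ioc)).neg
    simpa only [Pi.neg_apply, mul_neg, integral_neg, Complex.ofReal_neg, Finset.sum_neg_distrib,
      neg_neg] using hlim
  · exact tendsto_weighted_mean_of_antitoneOn hp hb hf hfint
end

section
/- Let p > 0 and let f : (0,1] → ℝ be a nonnegative decreasing function such that x ↦ x^{p-1} f(x) is Lebesgue integrable on (0,1]. Then lim_{n→∞} Σ_{k=1}^n f(k/n) [ (k/n)^p − ((k−1)/n)^p ] = p ∫_0^1 x^{p-1} f(x) dx. -/
open Filter Finset Topology MeasureTheory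

/-- On `(j/n, (j+1)/n]` the scaled ceiling `⌈x n⌉` equals `j + 1`. -/
theorem ceil_mul_eq_succ {n : ℕ} (hn : 0 < n) {j : ℕ} {x : ℝ}
    (hx : x ∈ Set.Ioc ((j : ℝ) / n) (((j + 1 : ℕ) : ℝ) / n)) :
    ⌈x * (n : ℝ)⌉₊ = j + 1 := by
  have hn' : (0 : ℝ) < n := by exact_mod_cast hn
  rw [Nat.ceil_eq_iff (Nat.succ_ne_zero j)]
  exact ⟨by simpa using (div_lt_iff₀ hn').1 hx.1, (le_div_iff₀ hn').1 hx.2⟩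

/-- The scaled ceiling `⌈x n⌉ / n` of a point of `(0, 1]` lies in `[x, 1]`. -/
theorem ceil_mul_div_mem_Icc {n : ℕ} (hn : 0 < n) {x : ℝ} (hx : x ∈ Set.Ioc (0 : ℝ) 1) :
    (⌈x * (n : ℝ)⌉₊ : ℝ) / n ∈ Set.Icc x 1 := by
  have hn' : (0 : ℝ) < n := by exact_mod_cast hn
  refine ⟨(le_div_iff₀ hn').2 (Nat.le_ceil _), (div_le_one hn').2 ?_⟩
  exact_mod_cast Nat.ceil_le.2 (mul_le_of_le_one_left hn'.le hx.2)

/-- The Riemann–Stieltjes sum for `d(x^p)` is the integral of `p x^(p-1)` against the step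
function `x ↦ f (⌈x n⌉ / n)`. -/
theorem riemann_stieltjes_sum_eq_integral {p : ℝ} (hp : 0 < p) (f : ℝ → ℝ) {n : ℕ}
    (hn : 0 < n) :
    ∑ k ∈ Finset.Icc 1 n, f ((k : ℝ) / (n : ℝ)) *
        (((k : ℝ) / (n : ℝ)) ^ p - (((k : ℝ) - 1) / (n : ℝ)) ^ p) =
      p * ∫ x in Set.Ioc (0 : ℝ) 1, x ^ (p - 1) * f ((⌈x * (n : ℝ)⌉₊ : ℝ) / n) := by
  have hn' : (n : ℝ) ≠ 0 := by exact_mod_cast hn.ne'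
  have hle (j : ℕ) : (j : ℝ) / n ≤ ((j + 1 : ℕ) : ℝ) / n := by gcongr; simp
  have heq (j : ℕ) : Set.EqOn (fun x : ℝ => x ^ (p - 1) * f (((j + 1 : ℕ) : ℝ) / n))
      (fun x : ℝ => x ^ (p - 1) * f ((⌈x * (n : ℝ)⌉₊ : ℝ) / n))
      (Set.uIoc ((j : ℝ) / n) (((j + 1 : ℕ) : ℝ) / n)) := by
    intro x hx
    rw [Set.uIoc_of_le (hle j)] at hx
    simp only [ceil_mul_eq_succ hn hx]
  have hint (j : ℕ) : IntervalIntegrable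
      (fun x : ℝ => x ^ (p - 1) * f ((⌈x * (n : ℝ)⌉₊ : ℝ) / n)) volume
      ((j : ℝ) / n) (((j + 1 : ℕ) : ℝ) / n) :=
    ((intervalIntegral.intervalIntegrable_rpow' (by linarith)).mul_const _).congr (heq j)
  have hsum := intervalIntegral.sum_integral_adjacent_intervals
    (a := fun j : ℕ => (j : ℝ) / n) (n := n) fun j _ => hint j
  simp only [Nat.cast_zero, zero_div, div_self hn'] at hsum
  rw [← intervalIntegral.integral_of_le zero_le_one, ← hsum, Finset.mul_sum,
    ← Finset.Ico_add_one_right_eq_Icc, Finset.sum_Ico_eq_sum_range, Nat.add_sub_cancel]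
  refine Finset.sum_congr rfl fun j _ => ?_
  rw [← intervalIntegral.integral_congr_ae (ae_of_all _ (heq j)), intervalIntegral.integral_mul_const,
    integral_rpow (Or.inl (by linarith)), add_comm 1 j, sub_add_cancel]
  push_cast
  rw [add_sub_cancel_right]
  field_simp

/-- **Convergence of Riemann–Stieltjes sums for `d(x^p)`.**
Let `p > 0` and let `f` be nonnegative and decreasing on `(0, 1]` with
`x ↦ x^(p-1) f x` Lebesgue integrable on `(0, 1]`. Then
`∑_{k=1}^n f(k/n) [(k/n)^p − ((k−1)/n)^p] → p ∫_0^1 x^(p-1) f x dx`. -/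
theorem riemann_stieltjes_sum_tendsto
    (p : ℝ) (hp : 0 < p) (f : ℝ → ℝ)
    (hpos : ∀ x ∈ Set.Ioc (0 : ℝ) 1, 0 ≤ f x)
    (hanti : AntitoneOn f (Set.Ioc 0 1))
    (hfint : IntegrableOn (fun x : ℝ => x ^ (p - 1) * f x) (Set.Ioc 0 1) volume) :
    Tendsto
      (fun n : ℕ => ∑ k ∈ Finset.Icc 1 n,
        f ((k : ℝ) / (n : ℝ)) *
          (((k : ℝ) / (n : ℝ)) ^ p - (((k : ℝ) - 1) / (n : ℝ)) ^ p))
      atTop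
      (𝓝 (p * ∫ x in Set.Ioc (0 : ℝ) 1, x ^ (p - 1) * f x)) := by
  have hmem {n : ℕ} (hn : 0 < n) {x : ℝ} (hx : x ∈ Set.Ioc (0 : ℝ) 1) :
      (⌈x * (n : ℝ)⌉₊ : ℝ) / n ∈ Set.Ioc (0 : ℝ) 1 :=
    have h := ceil_mul_div_mem_Icc hn hx
    ⟨hx.1.trans_le h.1, h.2⟩
  have hlim : Tendsto
      (fun n : ℕ => ∫ x in Set.Ioc (0 : ℝ) 1, x ^ (p - 1) * f ((⌈x * (n : ℝ)⌉₊ : ℝ) / n))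
      atTop (𝓝 (∫ x in Set.Ioc (0 : ℝ) 1, x ^ (p - 1) * f x)) := by
    refine tendsto_integral_filter_of_dominated_convergence _ (Eventually.of_forall fun n => ?_)
      ?_ hfint ?_
    · have hstep : Measurable fun x : ℝ => f ((⌈x * (n : ℝ)⌉₊ : ℝ) / n) :=
        (measurable_from_top (f := fun k : ℕ => f ((k : ℝ) / n))).comp
          (Nat.measurable_ceil.comp (measurable_id.mul_const (n : ℝ)))
      exact ((measurable_id.pow_const (p - 1)).mul hstep).aestronglyMeasurable
    · filter_upwards [eventually_gt_atTop 0] with n hn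
      filter_upwards [ae_restrict_mem measurableSet_Ioc] with x hx
      have hrpow : 0 ≤ x ^ (p - 1) := Real.rpow_nonneg hx.1.le _
      rw [Real.norm_of_nonneg (mul_nonneg hrpow (hpos _ (hmem hn hx)))]
      exact mul_le_mul_of_nonneg_left
        (hanti hx (hmem hn hx) (ceil_mul_div_mem_Icc hn hx).1) hrpow
    · filter_upwards [ae_restrict_mem measurableSet_Ioc,
        hanti.countable_not_continuousWithinAt.ae_notMem _] with x hx hcont
      have hcont : ContinuousWithinAt f (Set.Ioc 0 1) x := by
        by_contra h
        exact hcont ⟨hx, h⟩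
      refine Tendsto.const_mul _ (hcont.tendsto.comp (tendsto_nhdsWithin_iff.2 ⟨?_, ?_⟩))
      · exact (tendsto_nat_ceil_mul_div_atTop hx.1.le).comp tendsto_natCast_atTop_atTop
      · filter_upwards [eventually_gt_atTop 0] with n hn using hmem hn hx
  refine (hlim.const_mul p).congr' ?_
  filter_upwards [eventually_gt_atTop 0] with n hn
  exact (riemann_stieltjes_sum_eq_integral hp f hn).symm
end

section
/- Let p > 0, q > 0 and let b : ℕ → ℂ be a p-mean convergent sequence with limit β, i.e. n^{-p} Σ_{k=1}^n b_k → β. Then lim_{n→∞} n^{-(p+q)} Σ_{k=1}^n b_k k^q = β p / (p+q). -/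
open Filter Finset Topology

/-- Summation by parts for sums over `Icc 1 n`. -/
lemma sum_Icc_mul_eq_sub_sum_range {R : Type*} [CommRing R] (b w : ℕ → R) (n : ℕ) :
    ∑ k ∈ Icc 1 n, b k * w k =
      (∑ k ∈ Icc 1 n, b k) * w n -
        ∑ k ∈ range n, (∑ j ∈ Icc 1 k, b j) * (w (k + 1) - w k) := by
  induction n with
  | zero => simp
  | succ n ih =>
    rw [sum_Icc_succ_top (by omega), sum_Icc_succ_top (by omega), sum_range_succ, ih]
    ring

/-- The **Stolz–Cesàro theorem** for the averages of a sequence `u` against positive weights `g`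
whose partial sums diverge. -/
lemma tendsto_sum_range_div_of_tendsto_div {u : ℕ → ℂ} {g : ℕ → ℝ} {c : ℂ}
    (hg : ∀ n, 0 < g n) (hsum : Tendsto (fun n => ∑ k ∈ range n, g k) atTop atTop)
    (h : Tendsto (fun n => u n / (g n : ℂ)) atTop (𝓝 c)) :
    Tendsto (fun n => (∑ k ∈ range n, u k) / ((∑ k ∈ range n, g k : ℝ) : ℂ)) atTop (𝓝 c) := by
  have hg' : ∀ n, (g n : ℂ) ≠ 0 := fun n => Complex.ofReal_ne_zero.2 (hg n).ne'
  have hlittle : (fun n => u n - c * g n) =o[atTop] g := by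
    rw [← Asymptotics.isLittleO_norm_right]
    have : (fun n => u n - c * g n) =o[atTop] (fun n => (g n : ℂ)) := by
      rw [Asymptotics.isLittleO_iff_tendsto (fun n hn => absurd hn (hg' n))]
      refine (tendsto_sub_nhds_zero_iff.2 h).congr fun n => ?_
      rw [sub_div, mul_div_cancel_right₀ _ (hg' n)]
    simpa using this.norm_right
  have hs := hlittle.sum_range (fun n => (hg n).le) hsum
  have hs' : (fun n => ∑ k ∈ range n, (u k - c * g k)) =o[atTop]
      (fun n => ((∑ k ∈ range n, g k : ℝ) : ℂ)) := by
    rw [← Asymptotics.isLittleO_norm_right]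
    simpa only [Complex.norm_real] using hs.norm_right
  rw [← tendsto_sub_nhds_zero_iff]
  refine hs'.tendsto_div_nhds_zero.congr' ?_
  filter_upwards [hsum.eventually_gt_atTop 0] with n hn
  have hn' : ((∑ k ∈ range n, g k : ℝ) : ℂ) ≠ 0 := Complex.ofReal_ne_zero.2 hn.ne'
  rw [sum_sub_distrib, ← mul_sum, ← Complex.ofReal_sum, sub_div, mul_div_cancel_right₀ _ hn']

/-- `(n + 1) ^ r - n ^ r` is asymptotic to `r * n ^ (r - 1)`. -/
lemma tendsto_natCast_mul_rpow_succ_sub_rpow_div (r : ℝ) :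
    Tendsto (fun n : ℕ => (n : ℝ) * (((n + 1 : ℕ) : ℝ) ^ r - (n : ℝ) ^ r) / (n : ℝ) ^ r)
      atTop (𝓝 r) := by
  have hd : HasDerivAt (fun x : ℝ => x ^ r) r 1 := by
    simpa using Real.hasDerivAt_rpow_const (x := 1) (p := r) (Or.inl one_ne_zero)
  have hinv : Tendsto (fun n : ℕ => ((n : ℝ))⁻¹) atTop (𝓝[≠] 0) := by
    refine tendsto_nhdsWithin_iff.2 ⟨tendsto_inv_atTop_nhds_zero_nat, ?_⟩
    filter_upwards [eventually_gt_atTop 0] with n hn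
    simpa using hn.ne'
  refine (hd.tendsto_slope_zero.comp hinv).congr' ?_
  filter_upwards [eventually_gt_atTop 0] with n hn
  have hn' : (0 : ℝ) < n := by exact_mod_cast hn
  have hr : (n : ℝ) ^ r ≠ 0 := (Real.rpow_pos_of_pos hn' r).ne'
  have hfac : ((n + 1 : ℕ) : ℝ) ^ r = (n : ℝ) ^ r * (1 + (n : ℝ)⁻¹) ^ r := by
    rw [← Real.mul_rpow hn'.le (by positivity)]
    congr 1
    push_cast
    field_simp
  simp only [Function.comp_apply, Real.one_rpow, smul_eq_mul, inv_inv, hfac]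
  field_simp

/-- **Weighted Cesàro mean with weight `f(x) = x^q`.**
Let `p, q > 0` and let `b : ℕ → ℂ` (indexed by `ℕ = {1, 2, …}`) be `p`-mean convergent
with limit `β`. Then `n^{-(p+q)} ∑_{k=1}^n b_k k^q → β p / (p + q)`. -/
theorem weighted_cesaro_mean_pow_tendsto
    (p q : ℝ) (hp : 0 < p) (hq : 0 < q) (b : ℕ → ℂ) (β : ℂ)
    (hb : Tendsto (fun n : ℕ => ((((n : ℝ) ^ p : ℝ)) : ℂ)⁻¹ * ∑ k ∈ Finset.Icc 1 n, b k)
      atTop (𝓝 β)) :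
    Tendsto
      (fun n : ℕ => ((((n : ℝ) ^ (p + q) : ℝ)) : ℂ)⁻¹ *
        ∑ k ∈ Finset.Icc 1 n, b k * ((((k : ℝ) ^ q : ℝ)) : ℂ))
      atTop (𝓝 (β * (p : ℂ) / ((p : ℂ) + (q : ℂ)))) := by
  have hpq : 0 < p + q := add_pos hp hq
  set g : ℕ → ℝ := fun n => ((n + 1 : ℕ) : ℝ) ^ (p + q) - (n : ℝ) ^ (p + q) with hg_def
  set d : ℕ → ℝ := fun n => ((n + 1 : ℕ) : ℝ) ^ q - (n : ℝ) ^ q with hd_def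
  have hg : ∀ n, 0 < g n := fun n => sub_pos.2 <|
    Real.rpow_lt_rpow n.cast_nonneg (by exact_mod_cast n.lt_succ_self) hpq
  have hgsum : ∀ n, ∑ k ∈ range n, g k = (n : ℝ) ^ (p + q) := fun n => by
    rw [hg_def, sum_range_sub (fun k : ℕ => (k : ℝ) ^ (p + q))]
    simp [Real.zero_rpow hpq.ne']
  have hgtop : Tendsto (fun n => ∑ k ∈ range n, g k) atTop atTop := by
    simp only [hgsum]
    exact (tendsto_rpow_atTop hpq).comp tendsto_natCast_atTop_atTop
  have hratio : Tendsto (fun n : ℕ => (n : ℝ) ^ p * d n / g n) atTop (𝓝 (q / (p + q))) := by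
    refine ((tendsto_natCast_mul_rpow_succ_sub_rpow_div q).div
      (tendsto_natCast_mul_rpow_succ_sub_rpow_div (p + q)) hpq.ne').congr' ?_
    filter_upwards [eventually_gt_atTop 0] with n hn
    have hn' : (0 : ℝ) < n := by exact_mod_cast hn
    have h1 := (Real.rpow_pos_of_pos hn' p).ne'
    have h2 := (Real.rpow_pos_of_pos hn' q).ne'
    have h3 := (hg n).ne'
    change (n * d n / (n : ℝ) ^ q) / (n * g n / (n : ℝ) ^ (p + q)) = _
    rw [Real.rpow_add hn']
    field_simp
  have hquot : Tendsto (fun n => (∑ j ∈ Icc 1 n, b j) * (d n : ℂ) / (g n : ℂ)) atTop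
      (𝓝 (β * ((q / (p + q) : ℝ) : ℂ))) := by
    refine (hb.mul ((Complex.continuous_ofReal.tendsto _).comp hratio)).congr' ?_
    filter_upwards [eventually_gt_atTop 0] with n hn
    have hn' : (0 : ℝ) < n := by exact_mod_cast hn
    have h1 : (((n : ℝ) ^ p : ℝ) : ℂ) ≠ 0 :=
      Complex.ofReal_ne_zero.2 (Real.rpow_pos_of_pos hn' p).ne'
    simp only [Function.comp_apply, Complex.ofReal_div, Complex.ofReal_mul]
    field_simp
  have hlim := hb.sub (tendsto_sum_range_div_of_tendsto_div hg hgtop hquot)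
  have hpq' : (p : ℂ) + q ≠ 0 := by exact_mod_cast hpq.ne'
  have hval : β - β * ((q / (p + q) : ℝ) : ℂ) = β * p / (p + q) := by
    push_cast
    field_simp
    ring
  rw [hval] at hlim
  refine hlim.congr' ?_
  filter_upwards [eventually_gt_atTop 0] with n hn
  have hn' : (0 : ℝ) < n := by exact_mod_cast hn
  have h1 : (((n : ℝ) ^ p : ℝ) : ℂ) ≠ 0 :=
    Complex.ofReal_ne_zero.2 (Real.rpow_pos_of_pos hn' p).ne'
  have h2 : (((n : ℝ) ^ q : ℝ) : ℂ) ≠ 0 :=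
    Complex.ofReal_ne_zero.2 (Real.rpow_pos_of_pos hn' q).ne'
  rw [sum_Icc_mul_eq_sub_sum_range b (fun k => (((k : ℝ) ^ q : ℝ) : ℂ)), hgsum,
    Real.rpow_add hn']
  simp only [hd_def, Complex.ofReal_sub, Complex.ofReal_mul]
  field_simp
end

section
/- Let p > 0, q > 0 and let b : ℕ → ℂ be a p-mean convergent sequence with limit β, i.e. n^{-p} Σ_{k=1}^n b_k → β. Then lim_{n→∞} n^{-(p+q)} Σ_{k=1}^n b_k (n−k)^q = β · Γ(p+1) Γ(q+1) / Γ(p+q+1), where Γ denotes Euler's Gamma function. -/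
open Filter Finset Topology

open MeasureTheory in
/-- The density `q (1 - x) ^ (q - 1)` is integrable on the unit interval. -/
theorem integrableOn_one_sub_rpow {q : ℝ} (hq : 0 < q) :
    IntegrableOn (fun x : ℝ => q * (1 - x) ^ (q - 1)) (Set.Ioc 0 1) := by
  have h := ((intervalIntegral.intervalIntegrable_rpow' (a := 0) (b := 1)
    (show -1 < q - 1 by linarith)).comp_sub_left 1).symm.const_mul q
  simp only [sub_self, sub_zero] at h
  exact (intervalIntegrable_iff_integrableOn_Ioc_of_le zero_le_one).1 h

open MeasureTheory in
/-- Integrating the density `q (1 - x) ^ (q - 1)` over `[a, 1]` gives `(1 - a) ^ q`. -/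
theorem setIntegral_indicator_one_sub_rpow {q a : ℝ} (hq : 0 < q) (ha : 0 < a) (ha1 : a ≤ 1) :
    ∫ x in Set.Ioc (0 : ℝ) 1, (Set.Ici a).indicator (fun x => q * (1 - x) ^ (q - 1)) x
      = (1 - a) ^ q := by
  have hset : Set.Ioc (0 : ℝ) 1 ∩ Set.Ici a = Set.Icc a 1 := by
    ext x
    simp only [Set.mem_inter_iff, Set.mem_Ioc, Set.mem_Ici, Set.mem_Icc]
    constructor
    · rintro ⟨⟨_, h⟩, h'⟩
      exact ⟨h', h⟩
    · rintro ⟨h, h'⟩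
      exact ⟨⟨ha.trans_le h, h'⟩, h⟩
  rw [setIntegral_indicator measurableSet_Ici, hset, integral_Icc_eq_integral_Ioc,
    ← intervalIntegral.integral_of_le ha1, intervalIntegral.integral_const_mul,
    intervalIntegral.integral_comp_sub_left (fun x : ℝ => x ^ (q - 1)),
    integral_rpow (Or.inl (by linarith)), sub_self, sub_add_cancel, Real.zero_rpow hq.ne']
  field_simp
  ring

open MeasureTheory in
/-- The Beta integral `∫ q (1 - x) ^ (q - 1) x ^ p` over the unit interval. -/
theorem setIntegral_one_sub_rpow_mul_rpow {p q : ℝ} (hp : 0 < p) (hq : 0 < q) :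
    ∫ x in Set.Ioc (0 : ℝ) 1, q * (1 - x) ^ (q - 1) * x ^ p
      = Real.Gamma (p + 1) * Real.Gamma (q + 1) / Real.Gamma (p + q + 1) := by
  have hbeta : ((∫ x in Set.Ioc (0 : ℝ) 1, (1 - x) ^ (q - 1) * x ^ p : ℝ) : ℂ)
      = Complex.betaIntegral ((p + 1 : ℝ) : ℂ) (q : ℂ) := by
    rw [Complex.betaIntegral, intervalIntegral.integral_of_le zero_le_one, ← integral_complex_ofReal]
    refine setIntegral_congr_fun measurableSet_Ioc fun x hx => ?_
    have h1 : (0 : ℝ) ≤ 1 - x := by linarith [hx.2]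
    push_cast [Complex.ofReal_cpow h1, Complex.ofReal_cpow hx.1.le]
    rw [add_sub_cancel_right, mul_comm]
  have hreal : ∫ x in Set.Ioc (0 : ℝ) 1, (1 - x) ^ (q - 1) * x ^ p
      = Real.Gamma (p + 1) * Real.Gamma q / Real.Gamma (p + 1 + q) := by
    have h := ProbabilityTheory.beta_eq_betaIntegralReal (p + 1) q (by linarith) hq
    rw [← hbeta, Complex.ofReal_re] at h
    exact h.symm
  simp_rw [mul_assoc]
  rw [integral_const_mul, hreal, Real.Gamma_add_one hq.ne', show p + 1 + q = p + q + 1 by ring]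
  ring

open MeasureTheory in
/-- Abel summation in integral form: a Cesàro sum weighted by `(n - k) ^ q` is an average of
the partial sums against the density `q (1 - x) ^ (q - 1)`. -/
theorem weighted_sum_eq_setIntegral_partial_sums (p : ℝ) {q : ℝ} (hq : 0 < q) (b : ℕ → ℂ)
    {n : ℕ} (hn : 0 < n) :
    ((((n : ℝ) ^ (p + q) : ℝ)) : ℂ)⁻¹ *
        ∑ k ∈ Finset.Icc 1 n, b k * (((((n : ℝ) - (k : ℝ)) ^ q : ℝ)) : ℂ)
      = ∫ x in Set.Ioc (0 : ℝ) 1, ((q * (1 - x) ^ (q - 1) : ℝ) : ℂ) *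
          ((((n : ℝ) ^ p : ℝ) : ℂ)⁻¹ * ∑ k ∈ Finset.Icc 1 ⌊x * n⌋₊, b k) := by
  have hn' : (0 : ℝ) < n := by exact_mod_cast hn
  have hpt : ∀ x ∈ Set.Ioc (0 : ℝ) 1, ((q * (1 - x) ^ (q - 1) : ℝ) : ℂ) *
      ((((n : ℝ) ^ p : ℝ) : ℂ)⁻¹ * ∑ k ∈ Finset.Icc 1 ⌊x * n⌋₊, b k)
      = ∑ k ∈ Finset.Icc 1 n, (((n : ℝ) ^ p : ℝ) : ℂ)⁻¹ * b k *
        (((Set.Ici ((k : ℝ) / n)).indicator (fun x => q * (1 - x) ^ (q - 1)) x : ℝ) : ℂ) := by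
    intro x hx
    have hfilter : Finset.Icc 1 ⌊x * n⌋₊
        = (Finset.Icc 1 n).filter fun k : ℕ => (k : ℝ) / n ≤ x := by
      ext k
      simp only [Finset.mem_filter, Finset.mem_Icc, div_le_iff₀ hn',
        Nat.le_floor_iff (mul_nonneg hx.1.le hn'.le)]
      refine ⟨fun h => ⟨⟨h.1, ?_⟩, h.2⟩, fun h => ⟨h.1.1, h.2⟩⟩
      exact_mod_cast h.2.trans (mul_le_of_le_one_left hn'.le hx.2)
    rw [hfilter, Finset.sum_filter, Finset.mul_sum, Finset.mul_sum]
    refine Finset.sum_congr rfl fun k _ => ?_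
    by_cases hk : (k : ℝ) / n ≤ x
    · rw [if_pos hk, Set.indicator_of_mem (Set.mem_Ici.2 hk)]
      ring
    · rw [if_neg hk, Set.indicator_of_notMem (by simpa using hk)]
      simp
  rw [setIntegral_congr_fun measurableSet_Ioc hpt, integral_finsetSum]
  · rw [Finset.mul_sum]
    refine Finset.sum_congr rfl fun k hk => ?_
    obtain ⟨hk1, hkn⟩ := Finset.mem_Icc.1 hk
    have hkn' : (k : ℝ) ≤ n := by exact_mod_cast hkn
    have hpow : ((n : ℝ) ^ (p + q))⁻¹ * ((n : ℝ) - k) ^ q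
        = ((n : ℝ) ^ p)⁻¹ * (1 - (k : ℝ) / n) ^ q := by
      rw [one_sub_div hn'.ne', Real.div_rpow (by linarith) hn'.le, Real.rpow_add hn']
      field_simp
    have hpow' : (((n : ℝ) ^ (p + q) : ℝ) : ℂ)⁻¹ * ((((n : ℝ) - k) ^ q : ℝ) : ℂ)
        = (((n : ℝ) ^ p : ℝ) : ℂ)⁻¹ * (((1 - (k : ℝ) / n) ^ q : ℝ) : ℂ) := by
      exact_mod_cast hpow
    rw [integral_const_mul, integral_complex_ofReal,
      setIntegral_indicator_one_sub_rpow hq (by positivity) ((div_le_one hn').2 hkn')]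
    linear_combination b k * hpow'
  · intro k _
    exact ((integrableOn_one_sub_rpow hq).indicator measurableSet_Ici).ofReal.const_mul _

/-- If `n ^ (-p) * S n → β` then `n ^ (-p) * S ⌊x n⌋ → β x ^ p`. -/
theorem tendsto_inv_rpow_mul_comp_floor {p x : ℝ} (hp : 0 < p) (hx : 0 < x) {S : ℕ → ℂ} {β : ℂ}
    (hS : Tendsto (fun n : ℕ => (((n : ℝ) ^ p : ℝ) : ℂ)⁻¹ * S n) atTop (𝓝 β)) :
    Tendsto (fun n : ℕ => (((n : ℝ) ^ p : ℝ) : ℂ)⁻¹ * S ⌊x * n⌋₊) atTop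
      (𝓝 (β * ((x ^ p : ℝ) : ℂ))) := by
  have hfloor : Tendsto (fun n : ℕ => ⌊x * n⌋₊) atTop atTop :=
    tendsto_nat_floor_atTop.comp
      ((tendsto_natCast_atTop_atTop (R := ℝ)).const_mul_atTop hx)
  have hratio : Tendsto (fun n : ℕ => (((⌊x * n⌋₊ : ℝ) / n) ^ p : ℝ)) atTop (𝓝 (x ^ p)) :=
    (((tendsto_nat_floor_mul_div_atTop hx.le).comp
      (tendsto_natCast_atTop_atTop (R := ℝ))).rpow_const (Or.inr hp.le))
  have hratio' := (Complex.continuous_ofReal.tendsto (x ^ p)).comp hratio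
  refine ((hS.comp hfloor).mul hratio').congr' ?_
  filter_upwards [hfloor.eventually_gt_atTop 0] with n hn
  have hm : (((⌊x * n⌋₊ : ℝ) ^ p : ℝ) : ℂ) ≠ 0 := by
    exact_mod_cast (Real.rpow_pos_of_pos (by exact_mod_cast hn) p).ne'
  simp only [Function.comp_apply]
  rw [Real.div_rpow (Nat.cast_nonneg _) (Nat.cast_nonneg _), Complex.ofReal_div]
  field_simp

/-- A sequence with `n ^ (-p) * S n` convergent and `S 0 = 0` is bounded by a multiple of `n ^ p`. -/
theorem exists_norm_le_mul_rpow {p : ℝ} {S : ℕ → ℂ} {β : ℂ} (hS0 : S 0 = 0)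
    (hS : Tendsto (fun n : ℕ => (((n : ℝ) ^ p : ℝ) : ℂ)⁻¹ * S n) atTop (𝓝 β)) :
    ∃ C : ℝ, 0 ≤ C ∧ ∀ n : ℕ, ‖S n‖ ≤ C * (n : ℝ) ^ p := by
  obtain ⟨C, hC⟩ := hS.norm.bddAbove_range
  have hC' : ∀ n : ℕ, ‖(((n : ℝ) ^ p : ℝ) : ℂ)⁻¹ * S n‖ ≤ C := fun n => hC ⟨n, rfl⟩
  have hC0 : 0 ≤ C := (norm_nonneg _).trans (hC' 0)
  refine ⟨C, hC0, fun n => ?_⟩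
  rcases n.eq_zero_or_pos with rfl | hn
  · rw [hS0, norm_zero]
    positivity
  · have hpos : (0 : ℝ) < (n : ℝ) ^ p := Real.rpow_pos_of_pos (by exact_mod_cast hn) p
    have h := hC' n
    rw [norm_mul, norm_inv, Complex.norm_real, Real.norm_of_nonneg hpos.le,
      inv_mul_le_iff₀ hpos] at h
    linarith

/-- **Weighted Cesàro mean with weight `f(x) = (1-x)^q`.**
Let `p, q > 0` and let `b : ℕ → ℂ` (indexed by `ℕ = {1, 2, …}`) be `p`-mean convergent
with limit `β`. Then
`n^{-(p+q)} ∑_{k=1}^n b_k (n−k)^q → β Γ(p+1) Γ(q+1) / Γ(p+q+1)`. -/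
theorem weighted_cesaro_mean_one_sub_pow_tendsto
    (p q : ℝ) (hp : 0 < p) (hq : 0 < q) (b : ℕ → ℂ) (β : ℂ)
    (hb : Tendsto (fun n : ℕ => ((((n : ℝ) ^ p : ℝ)) : ℂ)⁻¹ * ∑ k ∈ Finset.Icc 1 n, b k)
      atTop (𝓝 β)) :
    Tendsto
      (fun n : ℕ => ((((n : ℝ) ^ (p + q) : ℝ)) : ℂ)⁻¹ *
        ∑ k ∈ Finset.Icc 1 n, b k * (((((n : ℝ) - (k : ℝ)) ^ q : ℝ)) : ℂ))
      atTop
      (𝓝 (β * ((Real.Gamma (p + 1) * Real.Gamma (q + 1) / Real.Gamma (p + q + 1) : ℝ) : ℂ))) := by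
  set S : ℕ → ℂ := fun n => ∑ k ∈ Finset.Icc 1 n, b k
  obtain ⟨C, hC0, hC⟩ := exists_norm_le_mul_rpow (S := S) (by simp [S]) hb
  have hlim : ∫ x in Set.Ioc (0 : ℝ) 1, ((q * (1 - x) ^ (q - 1) : ℝ) : ℂ) *
      (β * ((x ^ p : ℝ) : ℂ))
      = β * ((Real.Gamma (p + 1) * Real.Gamma (q + 1) / Real.Gamma (p + q + 1) : ℝ) : ℂ) := by
    rw [← setIntegral_one_sub_rpow_mul_rpow hp hq, ← integral_complex_ofReal,
      ← MeasureTheory.integral_const_mul]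
    congr 1 with x
    push_cast
    ring
  rw [← hlim]
  have hdom : Tendsto (fun n : ℕ => ∫ x in Set.Ioc (0 : ℝ) 1,
      ((q * (1 - x) ^ (q - 1) : ℝ) : ℂ) * ((((n : ℝ) ^ p : ℝ) : ℂ)⁻¹ * S ⌊x * n⌋₊)) atTop
      (𝓝 (∫ x in Set.Ioc (0 : ℝ) 1, ((q * (1 - x) ^ (q - 1) : ℝ) : ℂ) *
        (β * ((x ^ p : ℝ) : ℂ)))) := by
    refine MeasureTheory.tendsto_integral_of_dominated_convergence
      (fun x => q * (1 - x) ^ (q - 1) * C) (fun n => ?_)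
      ((integrableOn_one_sub_rpow hq).mul_const C) (fun n => ?_) ?_
    · have hfloor : Measurable fun x : ℝ => S ⌊x * n⌋₊ :=
        (measurable_from_nat (f := S)).comp
          (Nat.measurable_floor.comp (measurable_id.mul_const (n : ℝ)))
      exact (integrableOn_one_sub_rpow hq).ofReal.aestronglyMeasurable.mul
        (hfloor.const_mul _).aestronglyMeasurable
    · filter_upwards [MeasureTheory.ae_restrict_mem measurableSet_Ioc] with x hx
      have hw : 0 ≤ q * (1 - x) ^ (q - 1) :=
        mul_nonneg hq.le (Real.rpow_nonneg (by linarith [hx.2]) _)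
      have hn : (0 : ℝ) ≤ (n : ℝ) ^ p := by positivity
      have hfloor : (⌊x * n⌋₊ : ℝ) ≤ n :=
        (Nat.floor_le (mul_nonneg hx.1.le n.cast_nonneg)).trans
          (mul_le_of_le_one_left n.cast_nonneg hx.2)
      rw [norm_mul, norm_mul, norm_inv, Complex.norm_real, Complex.norm_real,
        Real.norm_of_nonneg hw, Real.norm_of_nonneg hn]
      gcongr
      refine inv_mul_le_of_le_mul₀ hn hC0 ((hC _).trans ?_)
      rw [mul_comm]
      gcongr
    · filter_upwards [MeasureTheory.ae_restrict_mem measurableSet_Ioc] with x hx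
      exact (tendsto_inv_rpow_mul_comp_floor hp hx.1 hb).const_mul _
  refine hdom.congr' ?_
  filter_upwards [eventually_gt_atTop 0] with n hn
  exact (weighted_sum_eq_setIntegral_partial_sums p hq b hn).symm
end

section
/- Let f : (0,1] → ℝ be defined by f(x) = m² if x = 1/m for some m ∈ ℕ, and f(x) = 0 otherwise. Then f = 0 Lebesgue-almost everywhere on (0,1] (so ∫_0^1 f(x) dx = 0), while for every n ∈ ℕ the uniform Riemann sum satisfies (1/n) Σ_{k=1}^n f(k/n) = n Σ_{d | n} d^{-2} ≥ n; in particular (1/n) Σ_{k=1}^n f(k/n) → +∞ as n → ∞, and the Riemann sums fail to converge to the integral of f. -/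
open Filter Finset Topology MeasureTheory

/-- A function vanishing on `(0, 1]` outside the points `1 / m` vanishes almost everywhere there. -/
theorem ae_restrict_Ioc_eq_zero_of_ne_one_div {f : ℝ → ℝ}
    (hf0 : ∀ x ∈ Set.Ioc (0 : ℝ) 1, (∀ m : ℕ, 1 ≤ m → x ≠ 1 / (m : ℝ)) → f x = 0) :
    ∀ᵐ x ∂(volume.restrict (Set.Ioc (0 : ℝ) 1)), f x = 0 := by
  rw [ae_restrict_iff' measurableSet_Ioc]
  have hcount : (Set.range fun m : ℕ => 1 / (m : ℝ)).Countable := Set.countable_range _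
  filter_upwards [hcount.ae_notMem volume] with x hx hx01
  exact hf0 x hx01 fun m _ h => hx ⟨m, h.symm⟩

theorem sum_Icc_div_eq_sq_mul_sum_divisors {f : ℝ → ℝ}
    (hf1 : ∀ m : ℕ, 1 ≤ m → f (1 / (m : ℝ)) = (m : ℝ) ^ 2)
    (hf0 : ∀ x ∈ Set.Ioc (0 : ℝ) 1, (∀ m : ℕ, 1 ≤ m → x ≠ 1 / (m : ℝ)) → f x = 0)
    {n : ℕ} (hn : 1 ≤ n) :
    ∑ k ∈ Finset.Icc 1 n, f ((k : ℝ) / (n : ℝ))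
      = (n : ℝ) ^ 2 * ∑ d ∈ n.divisors, ((d : ℝ) ^ 2)⁻¹ := by
  have hn0 : (0 : ℝ) < n := by exact_mod_cast hn
  have hsub : n.divisors ⊆ Finset.Icc 1 n := fun d hd =>
    Finset.mem_Icc.2 ⟨Nat.pos_of_mem_divisors hd, Nat.divisor_le hd⟩
  rw [Finset.mul_sum, ← Finset.sum_subset hsub]
  · refine Finset.sum_congr rfl fun d hd => ?_
    obtain ⟨m, rfl⟩ := Nat.dvd_of_mem_divisors hd
    have hm : 0 < m := Nat.pos_of_mul_pos_left hn
    have hd' : (d : ℝ) ≠ 0 := by exact_mod_cast (Nat.pos_of_mem_divisors hd).ne'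
    have hm' : (m : ℝ) ≠ 0 := by exact_mod_cast hm.ne'
    have hquot : (d : ℝ) / ((d * m : ℕ) : ℝ) = 1 / m := by
      push_cast
      field_simp
    rw [hquot, hf1 m hm]
    push_cast
    field_simp
  · intro k hk hkn
    obtain ⟨hk1, hk2⟩ := Finset.mem_Icc.1 hk
    have hk0 : (0 : ℝ) < k := by exact_mod_cast hk1
    refine hf0 _ ⟨by positivity, (div_le_one hn0).2 (by exact_mod_cast hk2)⟩ fun m hm h => hkn ?_
    have hm0 : (0 : ℝ) < m := by exact_mod_cast hm
    rw [div_eq_div_iff hn0.ne' hm0.ne', one_mul] at h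
    exact Nat.mem_divisors.2 ⟨⟨m, by exact_mod_cast h.symm⟩, by omega⟩

theorem one_le_sum_divisors_inv_sq {n : ℕ} (hn : n ≠ 0) :
    (1 : ℝ) ≤ ∑ d ∈ n.divisors, ((d : ℝ) ^ 2)⁻¹ := by
  calc (1 : ℝ) = (((1 : ℕ) : ℝ) ^ 2)⁻¹ := by norm_num
    _ ≤ ∑ d ∈ n.divisors, ((d : ℝ) ^ 2)⁻¹ :=
      Finset.single_le_sum (f := fun d : ℕ => ((d : ℝ) ^ 2)⁻¹)
        (fun d _ => by positivity) (Nat.one_mem_divisors.2 hn)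

/-- **A counterexample: Riemann sums need not converge to the integral.**
Let `f : (0,1] → ℝ` be `m²` at the points `1/m` (`m ∈ ℕ = {1, 2, …}`) and `0` elsewhere.
Then `f = 0` Lebesgue-a.e. on `(0,1]` (so `∫_0^1 f = 0`), while for every `n ≥ 1` the
uniform Riemann sum satisfies
`(1/n) ∑_{k=1}^n f(k/n) = n ∑_{d ∣ n} d⁻² ≥ n`; in particular the Riemann sums tend to
`+∞` and fail to converge to the integral of `f`. -/
theorem riemann_sums_counterexample
    (f : ℝ → ℝ)
    (hf1 : ∀ m : ℕ, 1 ≤ m → f (1 / (m : ℝ)) = (m : ℝ) ^ 2)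
    (hf0 : ∀ x ∈ Set.Ioc (0 : ℝ) 1, (∀ m : ℕ, 1 ≤ m → x ≠ 1 / (m : ℝ)) → f x = 0) :
    (∀ᵐ x ∂(volume.restrict (Set.Ioc (0 : ℝ) 1)), f x = 0) ∧
    (∫ x in Set.Ioc (0 : ℝ) 1, f x) = 0 ∧
    (∀ n : ℕ, 1 ≤ n →
      (1 / (n : ℝ)) * ∑ k ∈ Finset.Icc 1 n, f ((k : ℝ) / (n : ℝ))
        = (n : ℝ) * ∑ d ∈ n.divisors, ((d : ℝ) ^ 2)⁻¹) ∧
    (∀ n : ℕ, 1 ≤ n →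
      (n : ℝ) ≤ (1 / (n : ℝ)) * ∑ k ∈ Finset.Icc 1 n, f ((k : ℝ) / (n : ℝ))) ∧
    Tendsto (fun n : ℕ => (1 / (n : ℝ)) * ∑ k ∈ Finset.Icc 1 n, f ((k : ℝ) / (n : ℝ)))
      atTop atTop ∧
    ¬ Tendsto (fun n : ℕ => (1 / (n : ℝ)) * ∑ k ∈ Finset.Icc 1 n, f ((k : ℝ) / (n : ℝ)))
      atTop (𝓝 (∫ x in Set.Ioc (0 : ℝ) 1, f x)) := by
  have hae := ae_restrict_Ioc_eq_zero_of_ne_one_div hf0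
  have hsum : ∀ n : ℕ, 1 ≤ n →
      (1 / (n : ℝ)) * ∑ k ∈ Finset.Icc 1 n, f ((k : ℝ) / (n : ℝ))
        = (n : ℝ) * ∑ d ∈ n.divisors, ((d : ℝ) ^ 2)⁻¹ := by
    intro n hn
    have hn0 : (n : ℝ) ≠ 0 := by exact_mod_cast (Nat.one_le_iff_ne_zero.1 hn)
    rw [sum_Icc_div_eq_sq_mul_sum_divisors hf1 hf0 hn]
    field_simp
  have hle : ∀ n : ℕ, 1 ≤ n →
      (n : ℝ) ≤ (1 / (n : ℝ)) * ∑ k ∈ Finset.Icc 1 n, f ((k : ℝ) / (n : ℝ)) := by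
    intro n hn
    rw [hsum n hn]
    exact le_mul_of_one_le_right n.cast_nonneg
      (one_le_sum_divisors_inv_sq (Nat.one_le_iff_ne_zero.1 hn))
  have htop : Tendsto
      (fun n : ℕ => (1 / (n : ℝ)) * ∑ k ∈ Finset.Icc 1 n, f ((k : ℝ) / (n : ℝ)))
      atTop atTop :=
    tendsto_atTop_mono' _ ((eventually_ge_atTop 1).mono hle) tendsto_natCast_atTop_atTop
  exact ⟨hae, integral_eq_zero_of_ae hae, hsum, hle, htop, not_tendsto_nhds_of_tendsto_atTop htop _⟩
end

section
/- Define the double sequence a_{k_1,k_2} := (√k_1 − √(k_1−1)) √k_2 for k_1, k_2 ∈ ℕ, and b_k := 1 for all k ∈ ℕ. Then: (i) lim_{n→∞} n^{-2} Σ_{1 ≤ k_1, k_2 ≤ n} a_{k_1,k_2} = 2/3; (ii) lim_{n→∞} n^{-3} Σ_{k=1}^n Σ_{k+1 ≤ k_1, k_2 ≤ n} a_{k_1,k_2} = ∫_0^1 (1 − √x) ( ∫_x^1 √y dy ) dx = 8/45. Since Γ(2)Γ(3)/Γ(4) · (2/3) · 1 = 2/9 ≠ 8/45, the tail-average formula lim_{n→∞}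 n^{-(p+q)} Σ_{k=1}^n b_k Σ_{k+1 ≤ k_1,k_2 ≤ n} a_{k_1,k_2} = αβ Γ(p+1)Γ(q+1)/Γ(p+q+1) (here with p = 1, q = 2, m = 2, α = 2/3, β = 1) fails when the translation-invariance hypothesis a_{k_1−h,…,k_m−h} = a_{k_1,…,k_m} is dropped. -/
open Filter Finset Topology MeasureTheory

/-- Comparison of `∑ √k` with `∫ √x`. -/
lemma sum_sqrt_mem_Icc (n : ℕ) :
    ∑ k ∈ Icc 1 n, √(k : ℝ) ∈
      Set.Icc (2 / 3 * (√(n : ℝ)) ^ 3) (2 / 3 * (√(n : ℝ)) ^ 3 + √(n : ℝ)) := by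
  induction n with
  | zero => simp
  | succ n ih =>
    rw [Finset.sum_Icc_succ_top (by omega)]
    have hs : 0 ≤ √(n : ℝ) := Real.sqrt_nonneg _
    have ht : 0 ≤ √((n + 1 : ℕ) : ℝ) := Real.sqrt_nonneg _
    have hst : √(n : ℝ) ≤ √((n + 1 : ℕ) : ℝ) := Real.sqrt_le_sqrt (by push_cast; linarith)
    have hsq : √((n + 1 : ℕ) : ℝ) ^ 2 - √(n : ℝ) ^ 2 = 1 := by
      rw [Real.sq_sqrt (by positivity), Real.sq_sqrt (by positivity)]; push_cast; ring
    generalize √(n : ℝ) = s at *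
    generalize √((n + 1 : ℕ) : ℝ) = t at *
    obtain ⟨h₁, h₂⟩ := ih
    have hd : 0 ≤ t - s := by linarith
    have upper : 0 ≤ (t - s) * ((t - s) * (t + 2 * s)) := by positivity
    have lower : 0 ≤ (t - s) * ((t - s) * (2 * t + s)) := by positivity
    constructor
    · linear_combination h₁ + upper / 3 + t * hsq
    · linear_combination h₂ + lower / 3 - s * hsq

/-- Comparison of `∑ k √k` with `∫ x √x`. -/
lemma sum_sqrt_cube_mem_Icc (n : ℕ) :
    ∑ k ∈ Icc 1 n, √(k : ℝ) ^ 3 ∈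
      Set.Icc (2 / 5 * (√(n : ℝ)) ^ 5) (2 / 5 * (√(n : ℝ)) ^ 5 + √(n : ℝ) ^ 3) := by
  induction n with
  | zero => simp
  | succ n ih =>
    rw [Finset.sum_Icc_succ_top (by omega)]
    have hs : 0 ≤ √(n : ℝ) := Real.sqrt_nonneg _
    have ht : 0 ≤ √((n + 1 : ℕ) : ℝ) := Real.sqrt_nonneg _
    have hst : √(n : ℝ) ≤ √((n + 1 : ℕ) : ℝ) := Real.sqrt_le_sqrt (by push_cast; linarith)
    have hsq : √((n + 1 : ℕ) : ℝ) ^ 2 - √(n : ℝ) ^ 2 = 1 := by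
      rw [Real.sq_sqrt (by positivity), Real.sq_sqrt (by positivity)]; push_cast; ring
    generalize √(n : ℝ) = s at *
    generalize √((n + 1 : ℕ) : ℝ) = t at *
    obtain ⟨h₁, h₂⟩ := ih
    have hd : 0 ≤ t - s := by linarith
    have upper : 0 ≤ (t - s) * ((t - s) * (3 * t ^ 3 + 6 * t ^ 2 * s + 4 * t * s ^ 2
        + 2 * s ^ 3)) := by positivity
    have lower : 0 ≤ (t - s) * ((t - s) * (2 * t ^ 3 + 4 * t ^ 2 * s + 6 * t * s ^ 2
        + 3 * s ^ 3)) := by positivity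
    constructor
    · linear_combination h₁ + upper / 5 + t ^ 3 * hsq
    · linear_combination h₂ + lower / 5 - s ^ 3 * hsq

lemma sum_sqrt_sub_sqrt_pred {k n : ℕ} (h : k ≤ n) :
    ∑ j ∈ Icc (k + 1) n, (√(j : ℝ) - √((j : ℝ) - 1)) = √(n : ℝ) - √(k : ℝ) := by
  induction n, h using Nat.le_induction with
  | base => simp
  | succ n hn ih =>
    rw [Finset.sum_Icc_succ_top (by omega), ih]
    push_cast
    rw [add_sub_cancel_right]
    ring

lemma sum_Icc_succ_eq_sub (f : ℕ → ℝ) {k n : ℕ} (h : k ≤ n) :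
    ∑ j ∈ Icc (k + 1) n, f j = ∑ j ∈ Icc 1 n, f j - ∑ j ∈ Icc 1 k, f j := by
  induction n, h using Nat.le_induction with
  | base => simp
  | succ n hn ih =>
    rw [Finset.sum_Icc_succ_top (by omega), Finset.sum_Icc_succ_top (by omega), ih]
    ring

lemma sum_Icc_sq (n : ℕ) :
    ∑ k ∈ Icc 1 n, (k : ℝ) ^ 2 = (n : ℝ) * (n + 1) * (2 * n + 1) / 6 := by
  induction n with
  | zero => simp
  | succ n ih =>
    rw [Finset.sum_Icc_succ_top (by omega), ih]
    push_cast
    ring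

/-- The tail sum of `(√k₁ - √(k₁ - 1)) √k₂` telescopes in `k₁`. -/
lemma tail_sum_eq {a : ℕ → ℕ → ℝ}
    (ha : ∀ k₁ k₂ : ℕ, 1 ≤ k₁ → 1 ≤ k₂ →
      a k₁ k₂ = (√(k₁ : ℝ) - √((k₁ : ℝ) - 1)) * √(k₂ : ℝ)) {k n : ℕ} (h : k ≤ n) :
    ∑ k₁ ∈ Icc (k + 1) n, ∑ k₂ ∈ Icc (k + 1) n, a k₁ k₂ =
      (√(n : ℝ) - √(k : ℝ)) * (∑ j ∈ Icc 1 n, √(j : ℝ) - ∑ j ∈ Icc 1 k, √(j : ℝ)) := by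
  rw [← sum_sqrt_sub_sqrt_pred h, ← sum_Icc_succ_eq_sub _ h, Finset.sum_mul_sum]
  refine Finset.sum_congr rfl fun i hi => Finset.sum_congr rfl fun j hj => ?_
  rw [Finset.mem_Icc] at hi hj
  exact ha i j (by omega) (by omega)

lemma abs_sum_tail_sub_le (n : ℕ) :
    |∑ k ∈ Icc 1 n, (√(n : ℝ) - √(k : ℝ)) *
        (∑ j ∈ Icc 1 n, √(j : ℝ) - ∑ j ∈ Icc 1 k, √(j : ℝ)) - 8 / 45 * (n : ℝ) ^ 3| ≤
      4 * (n : ℝ) ^ 2 := by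
  have hs : 0 ≤ √(n : ℝ) := Real.sqrt_nonneg _
  have hn : √(n : ℝ) ^ 2 = n := Real.sq_sqrt (by positivity)
  have main : ∑ k ∈ Icc 1 n, (√(n : ℝ) - √(k : ℝ)) *
      (2 / 3 * √(n : ℝ) ^ 3 - 2 / 3 * √(k : ℝ) ^ 3) =
      2 / 3 * ((n : ℝ) ^ 3 - √(n : ℝ) ^ 3 * ∑ k ∈ Icc 1 n, √(k : ℝ)
        - √(n : ℝ) * ∑ k ∈ Icc 1 n, √(k : ℝ) ^ 3
        + (n : ℝ) * (n + 1) * (2 * n + 1) / 6) := by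
    rw [← sum_Icc_sq, Finset.mul_sum, Finset.mul_sum]
    have hc : (n : ℝ) ^ 3 = ∑ k ∈ Icc 1 n, (n : ℝ) ^ 2 := by
      simp; ring
    rw [hc, ← Finset.sum_sub_distrib, ← Finset.sum_sub_distrib, ← Finset.sum_add_distrib,
      Finset.mul_sum]
    refine Finset.sum_congr rfl fun k _ => ?_
    have hk : √(k : ℝ) ^ 2 = k := Real.sq_sqrt (by positivity)
    linear_combination 2 / 3 * (n + √(n : ℝ) ^ 2) * hn + 2 / 3 * (k + √(k : ℝ) ^ 2) * hk
  have err : |∑ k ∈ Icc 1 n, (√(n : ℝ) - √(k : ℝ)) *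
      (∑ j ∈ Icc 1 n, √(j : ℝ) - ∑ j ∈ Icc 1 k, √(j : ℝ)) -
      ∑ k ∈ Icc 1 n, (√(n : ℝ) - √(k : ℝ)) *
      (2 / 3 * √(n : ℝ) ^ 3 - 2 / 3 * √(k : ℝ) ^ 3)| ≤ (n : ℝ) ^ 2 := by
    rw [← Finset.sum_sub_distrib]
    refine (Finset.abs_sum_le_sum_abs _ _).trans ?_
    have hc : (n : ℝ) ^ 2 = ∑ k ∈ Icc 1 n, √(n : ℝ) * √(n : ℝ) := by
      rw [Real.mul_self_sqrt (by positivity)]; simp; ring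
    rw [hc]
    refine Finset.sum_le_sum fun k hk => ?_
    rw [Finset.mem_Icc] at hk
    have hk0 : 0 ≤ √(k : ℝ) := Real.sqrt_nonneg _
    have hkn : √(k : ℝ) ≤ √(n : ℝ) := Real.sqrt_le_sqrt (by exact_mod_cast hk.2)
    obtain ⟨h₁, h₂⟩ := sum_sqrt_mem_Icc n
    obtain ⟨h₃, h₄⟩ := sum_sqrt_mem_Icc k
    rw [← mul_sub, abs_mul]
    refine mul_le_mul ?_ ?_ (abs_nonneg _) hs
    · rw [abs_le]; constructor <;> linarith
    · rw [abs_le]; constructor <;> linarith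
  obtain ⟨h₁, h₂⟩ := sum_sqrt_mem_Icc n
  obtain ⟨h₃, h₄⟩ := sum_sqrt_cube_mem_Icc n
  have hnn : (n : ℝ) ≤ (n : ℝ) ^ 2 := by exact_mod_cast Nat.le_self_pow two_ne_zero n
  rw [main, abs_le] at err
  have h₁' := mul_le_mul_of_nonneg_left h₁ (pow_nonneg hs 3)
  have h₂' := mul_le_mul_of_nonneg_left h₂ (pow_nonneg hs 3)
  have h₃' := mul_le_mul_of_nonneg_left h₃ hs
  have h₄' := mul_le_mul_of_nonneg_left h₄ hs
  have p₄ : √(n : ℝ) ^ 4 = (n : ℝ) ^ 2 := by linear_combination (√(n : ℝ) ^ 2 + n) * hn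
  have p₆ : √(n : ℝ) ^ 6 = (n : ℝ) ^ 3 := by
    linear_combination (√(n : ℝ) ^ 4 + √(n : ℝ) ^ 2 * n + n ^ 2) * hn
  ring_nf at h₁' h₂' h₃' h₄' err ⊢
  rw [p₆] at h₁' h₂' h₃' h₄'
  rw [p₄] at h₂' h₄'
  rw [abs_le]
  constructor <;> linarith [err.1, err.2]

/-- A sequence within `C n ^ d` of `c n ^ (d + 1)` is asymptotic to it after normalisation. -/
lemma tendsto_inv_pow_mul_of_abs_sub_le {f : ℕ → ℝ} {c C : ℝ} {d : ℕ}
    (h : ∀ n : ℕ, |f n - c * (n : ℝ) ^ (d + 1)| ≤ C * (n : ℝ) ^ d) :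
    Tendsto (fun n : ℕ => ((n : ℝ) ^ (d + 1))⁻¹ * f n) atTop (𝓝 c) := by
  rw [tendsto_iff_norm_sub_tendsto_zero]
  refine squeeze_zero' (Eventually.of_forall fun n => norm_nonneg _) ?_
    (tendsto_const_div_atTop_nhds_zero_nat C)
  filter_upwards [eventually_gt_atTop 0] with n hn
  have hn : (0 : ℝ) < n := by exact_mod_cast hn
  have e : ((n : ℝ) ^ (d + 1))⁻¹ * f n - c =
      ((n : ℝ) ^ (d + 1))⁻¹ * (f n - c * (n : ℝ) ^ (d + 1)) := by
    field_simp
  rw [Real.norm_eq_abs, e, abs_mul, abs_of_pos (by positivity)]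
  refine (mul_le_mul_of_nonneg_left (h n) (by positivity)).trans_eq ?_
  field_simp
  ring

lemma hasDerivAt_sqrt_pow {x : ℝ} (hx : 0 < x) (d : ℕ) :
    HasDerivAt (fun y : ℝ => √y ^ (d + 2)) ((d + 2) / 2 * √x ^ d) x := by
  refine ((Real.hasDerivAt_sqrt hx.ne').pow (d + 2)).congr_deriv ?_
  have : 0 < √x := Real.sqrt_pos.2 hx
  push_cast
  field_simp
  ring

lemma setIntegral_sqrt_Ioc {x : ℝ} (hx : 0 ≤ x) (hx1 : x ≤ 1) :
    ∫ y in Set.Ioc x 1, √y = 2 / 3 * (1 - √x ^ 3) := by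
  rw [← intervalIntegral.integral_of_le hx1,
    intervalIntegral.integral_eq_sub_of_hasDerivAt_of_le hx1 (f := fun y => 2 / 3 * √y ^ 3)
      (by fun_prop) (fun y hy => ?_) (Continuous.intervalIntegrable (by fun_prop) _ _)]
  · simp; ring
  · refine ((hasDerivAt_sqrt_pow (hx.trans_lt hy.1) 1).const_mul (2 / 3)).congr_deriv ?_
    push_cast
    ring

lemma setIntegral_tail_eq :
    ∫ x in Set.Ioc (0 : ℝ) 1, (1 - √x) * ∫ y in Set.Ioc x 1, √y = 8 / 45 := by
  have e : ∫ x in Set.Ioc (0 : ℝ) 1, (1 - √x) * ∫ y in Set.Ioc x 1, √y =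
      ∫ x in Set.Ioc (0 : ℝ) 1, (1 - √x) * (2 / 3 * (1 - √x ^ 3)) :=
    setIntegral_congr_fun measurableSet_Ioc fun x hx => by
      simp only [setIntegral_sqrt_Ioc hx.1.le hx.2]
  rw [e, ← intervalIntegral.integral_of_le zero_le_one,
    intervalIntegral.integral_eq_sub_of_hasDerivAt_of_le zero_le_one
      (f := fun x => 2 / 3 * (√x ^ 2 - 2 / 3 * √x ^ 3 - 2 / 5 * √x ^ 5 + 1 / 3 * √x ^ 6))
      (by fun_prop) (fun x hx => ?_) (Continuous.intervalIntegrable (by fun_prop) _ _)]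
  · norm_num
  · refine (((((hasDerivAt_sqrt_pow hx.1 0).sub
      ((hasDerivAt_sqrt_pow hx.1 1).const_mul (2 / 3))).sub
      ((hasDerivAt_sqrt_pow hx.1 3).const_mul (2 / 5))).add
      ((hasDerivAt_sqrt_pow hx.1 4).const_mul (1 / 3))).const_mul (2 / 3)).congr_deriv ?_
    push_cast
    ring

/-- **A counterexample to the tail-average formula without translation invariance.**
With `a_{k₁,k₂} = (√k₁ − √(k₁−1)) √k₂` (`k₁, k₂ ∈ ℕ = {1, 2, …}`) and `b_k = 1`:
(i) `n⁻² ∑_{1 ≤ k₁,k₂ ≤ n} a_{k₁,k₂} → 2/3`;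
(ii) `n⁻³ ∑_{k=1}^n ∑_{k+1 ≤ k₁,k₂ ≤ n} a_{k₁,k₂} → 8/45`, which equals
`∫_0^1 (1 − √x) (∫_x^1 √y dy) dx`; and `8/45 ≠ (2/3)·1·Γ(2)Γ(3)/Γ(4) = 2/9`,
so the tail-average formula (with `p = 1`, `q = 2`, `m = 2`, `α = 2/3`, `β = 1`)
fails without translation invariance. -/
theorem tail_average_counterexample
    (a : ℕ → ℕ → ℝ)
    (ha : ∀ k₁ k₂ : ℕ, 1 ≤ k₁ → 1 ≤ k₂ →
      a k₁ k₂ = (Real.sqrt (k₁ : ℝ) - Real.sqrt ((k₁ : ℝ) - 1)) * Real.sqrt (k₂ : ℝ)) :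
    Tendsto
      (fun n : ℕ => ((n : ℝ) ^ 2)⁻¹ *
        ∑ k₁ ∈ Finset.Icc 1 n, ∑ k₂ ∈ Finset.Icc 1 n, a k₁ k₂)
      atTop (𝓝 (2 / 3)) ∧
    Tendsto
      (fun n : ℕ => ((n : ℝ) ^ 3)⁻¹ * ∑ k ∈ Finset.Icc 1 n,
        ∑ k₁ ∈ Finset.Icc (k + 1) n, ∑ k₂ ∈ Finset.Icc (k + 1) n, a k₁ k₂)
      atTop (𝓝 (8 / 45)) ∧
    (∫ x in Set.Ioc (0 : ℝ) 1,
      (1 - Real.sqrt x) * ∫ y in Set.Ioc x 1, Real.sqrt y) = 8 / 45 ∧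
    (8 : ℝ) / 45 ≠ (2 / 3) * 1 *
      (Real.Gamma (1 + 1) * Real.Gamma (2 + 1) / Real.Gamma (1 + 2 + 1)) := by
  refine ⟨tendsto_inv_pow_mul_of_abs_sub_le (C := 1) fun n => ?_,
    tendsto_inv_pow_mul_of_abs_sub_le (C := 4) fun n => ?_, setIntegral_tail_eq, ?_⟩
  · have h := tail_sum_eq ha (Nat.zero_le n)
    simp only [zero_add, Nat.cast_zero, Real.sqrt_zero, sub_zero, Finset.Icc_eq_empty_of_lt
      zero_lt_one, Finset.sum_empty] at h
    rw [h]
    obtain ⟨h₁, h₂⟩ := sum_sqrt_mem_Icc n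
    have hs : 0 ≤ √(n : ℝ) := Real.sqrt_nonneg _
    have hn : (n : ℝ) = √(n : ℝ) ^ 2 := (Real.sq_sqrt (by positivity)).symm
    have h₁' := mul_le_mul_of_nonneg_left h₁ hs
    have h₂' := mul_le_mul_of_nonneg_left h₂ hs
    have p₂ : (n : ℝ) ^ (1 + 1) = √(n : ℝ) ^ 4 := by
      rw [show √(n : ℝ) ^ 4 = (√(n : ℝ) ^ 2) ^ 2 by ring, ← hn]
    rw [abs_le, p₂, pow_one]
    constructor <;> linarith
  · rw [Finset.sum_congr rfl fun k hk => tail_sum_eq ha (Finset.mem_Icc.1 hk).2]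
    exact abs_sum_tail_sub_le n
  · rw [show (1 + 1 : ℝ) = (1 : ℕ) + 1 by norm_num, show (2 + 1 : ℝ) = (2 : ℕ) + 1 by norm_num,
      show (1 + 2 + 1 : ℝ) = (3 : ℕ) + 1 by norm_num, Real.Gamma_nat_eq_factorial,
      Real.Gamma_nat_eq_factorial, Real.Gamma_nat_eq_factorial]
    norm_num [Nat.factorial]
end
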